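/- arXiv:2002.12607 — 2 statements merged into one kernel-verified Lean document; each statement's English description precedes it below -/
import Mathlib

section
/- For every set S ⊆ {1,…,m} of measurement indices, the submatrix F^S ∈ ℂ^{m×|S|} has full column rank |S| if and only if S is a non-critical set of measurements. -/
open Matrix

/-- The verification matrix `F := H (Hᴴ H)⁻¹ Hᴴ - Id`. -/
noncomputable def verif {m n : ℕ} (H : Matrix (Fin m) (Fin n) ℂ) :
    Matrix (Fin m) (Fin m) ℂ :=
  H * (Hᴴ * H)⁻¹ * Hᴴ - 1

/-- A set `S` of measurement (row) indices is critical if deleting the rows of `H`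
with indices in `S` leaves a matrix of rank `< n`. -/
def IsCritical {m n : ℕ} (H : Matrix (Fin m) (Fin n) ℂ) (S : Finset (Fin m)) : Prop :=
  (H.submatrix (fun i : {i : Fin m // i ∉ S} => (i : Fin m)) id).rank < n

/-- `F^S`: the submatrix of `F` formed by the columns with indices in `S`. -/
def colSub {m : ℕ} (F : Matrix (Fin m) (Fin m) ℂ) (S : Finset (Fin m)) :
    Matrix (Fin m) {j : Fin m // j ∈ S} ℂ :=
  F.submatrix id (fun j => (j : Fin m))

theorem Matrix.rank_eq_card_iff_mulVec_eq_zero {K ι κ : Type*} [Field K] [Finite ι] [Fintype κ]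
    (A : Matrix ι κ K) : A.rank = Fintype.card κ ↔ ∀ v, A *ᵥ v = 0 → v = 0 := by
  have h := A.mulVecLin.finrank_range_add_finrank_ker
  rw [Module.finrank_fintype_fun_eq_card] at h
  have hker : (∀ v, A *ᵥ v = 0 → v = 0) ↔ Module.finrank K (LinearMap.ker A.mulVecLin) = 0 := by
    rw [Submodule.finrank_eq_zero, LinearMap.ker_eq_bot']
    rfl
  rw [hker, Matrix.rank]
  omega

theorem colSub_mulVec {m : ℕ} (F : Matrix (Fin m) (Fin m) ℂ) (S : Finset (Fin m))
    (w : Fin m → ℂ) (hw : ∀ i ∉ S, w i = 0) :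
    colSub F S *ᵥ (fun j => w j) = F *ᵥ w := by
  ext i
  simp only [colSub, mulVec, dotProduct, submatrix_apply, id]
  rw [Finset.sum_coe_sort S (fun j => F i j * w j)]
  exact Finset.sum_subset S.subset_univ fun j _ hj => by rw [hw j hj, mul_zero]

open scoped ComplexOrder in
theorem verif_mulVec_eq_zero_iff {m n : ℕ} (H : Matrix (Fin m) (Fin n) ℂ) (hH : H.rank = n)
    (w : Fin m → ℂ) : verif H *ᵥ w = 0 ↔ ∃ x, H *ᵥ x = w := by
  have hU : IsUnit (Hᴴ * H) := by
    rw [← Matrix.mulVec_injective_iff_isUnit]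
    have h := (Hᴴ * H).rank_eq_card_iff_mulVec_eq_zero.1
      (by rw [rank_conjTranspose_mul_self, hH, Fintype.card_fin])
    intro x y hxy
    exact sub_eq_zero.1 (h _ (by rw [mulVec_sub, sub_eq_zero]; exact hxy))
  rw [verif, sub_mulVec, one_mulVec, sub_eq_zero]
  constructor
  · intro h
    exact ⟨((Hᴴ * H)⁻¹ * Hᴴ) *ᵥ w, by rw [mulVec_mulVec, ← Matrix.mul_assoc, h]⟩
  · rintro ⟨x, rfl⟩
    rw [mulVec_mulVec, Matrix.mul_assoc, Matrix.mul_assoc,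
      Matrix.nonsing_inv_mul _ ((Matrix.isUnit_iff_isUnit_det _).1 hU), Matrix.mul_one]

/-- `F^S` has full column rank `|S|` iff `S` is a non-critical set of measurements. -/
theorem stmt0 {m n : ℕ} (H : Matrix (Fin m) (Fin n) ℂ) (hH : H.rank = n)
    (S : Finset (Fin m)) :
    (colSub (verif H) S).rank = S.card ↔ ¬ IsCritical H S := by
  have hinj := H.rank_eq_card_iff_mulVec_eq_zero.1 (by rw [hH, Fintype.card_fin])
  have hcol := (colSub (verif H) S).rank_eq_card_iff_mulVec_eq_zero
  rw [Fintype.card_coe] at hcol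
  set G := H.submatrix (fun i : {i : Fin m // i ∉ S} => (i : Fin m)) id with hG
  have hrow := G.rank_eq_card_iff_mulVec_eq_zero
  have hle : G.rank ≤ n := by simpa using G.rank_le_card_width
  have hGx (x : Fin n → ℂ) : G *ᵥ x = 0 ↔ ∀ i ∉ S, (H *ᵥ x) i = 0 := by
    simp [funext_iff, hG, mulVec, dotProduct]
  have hcrit : ¬ IsCritical H S ↔ G.rank = Fintype.card (Fin n) := by
    rw [IsCritical, ← hG, Fintype.card_fin]
    omega
  rw [hcol, hcrit, hrow]
  constructor
  · intro h x hx
    rw [hGx] at hx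
    have h0 := h (fun j => (H *ᵥ x) j) (by
      rw [colSub_mulVec _ _ _ hx, verif_mulVec_eq_zero_iff H hH]
      exact ⟨x, rfl⟩)
    refine hinj x (funext fun i => ?_)
    by_cases hi : i ∈ S
    · exact congrFun h0 ⟨i, hi⟩
    · exact hx i hi
  · intro h v hv
    let w : Fin m → ℂ := fun i => if hi : i ∈ S then v ⟨i, hi⟩ else 0
    have hw : ∀ i ∉ S, w i = 0 := fun i hi => dif_neg hi
    have hwv : (fun j : {j // j ∈ S} => w j) = v := funext fun j => dif_pos j.2
    rw [← hwv, colSub_mulVec _ _ _ hw, verif_mulVec_eq_zero_iff H hH] at hv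
    obtain ⟨x, hx⟩ := hv
    have hx0 := h x ((hGx x).2 (by rwa [hx]))
    rw [hx0, mulVec_zero] at hx
    rw [← hwv, ← hx]
    rfl
end

section
/- Let a, b ∈ ℂ^m both be nonzero, let W := [a b]†[a b] be the associated 2×2 Hermitian positive-semidefinite attack-angle matrix with eigenvalues λ1 ≥ λ2 ≥ 0 (note λ1 + λ2 = ‖a‖² + ‖b‖² > 0), and define the index of separation IoS := λ1/(λ1 + λ2). Then IoS = 1 if and only if there exists l ∈ ℂ with l ≠ 0 such that a = l·b. In the grid setting, with a = F^{S1}z_1 and b = F^{S2}z_2 for two sites each measuring a single non-zero, non-critical phasor, this states that IoS_{1,2}(z_1,z_2) = 1 if and only if F^{S1}z_1 and F^{S2}z_2 are colinear. -/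
open Matrix

/-- A nontrivial combination of two nonzero vectors vanishes iff they are nonzero multiples of each
other. -/
lemma exists_ne_zero_add_eq_zero_iff {K V : Type*} [Field K] [AddCommGroup V] [Module K V]
    {a b : V} (ha : a ≠ 0) (hb : b ≠ 0) :
    (∃ v : Fin 2 → K, v ≠ 0 ∧ v 0 • a + v 1 • b = 0) ↔ ∃ l : K, l ≠ 0 ∧ a = l • b := by
  constructor
  · rintro ⟨v, hv, h⟩
    have h0 : v 0 ≠ 0 := by
      intro h0
      have h1 : v 1 = 0 := by simpa [h0, hb] using h
      exact hv (funext (Fin.forall_fin_two.2 ⟨h0, h1⟩))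
    have hab : a = (-((v 0)⁻¹ * v 1)) • b := by
      rw [neg_smul, mul_smul, ← smul_neg, ← eq_neg_of_add_eq_zero_left h, inv_smul_smul₀ h0]
    refine ⟨_, fun hl => ha ?_, hab⟩
    rw [hab, hl, zero_smul]
  · rintro ⟨l, -, h⟩
    exact ⟨![1, -l], fun h0 => one_ne_zero (congrFun h0 0), by simp [h]⟩

/-- The Gram matrix of the columns of `M` is singular iff the columns are linearly dependent. -/
lemma det_conjTranspose_mul_self_eq_zero_iff {m n : Type*} [Fintype m] [Fintype n] [DecidableEq n]
    (M : Matrix m n ℂ) : (Mᴴ * M).det = 0 ↔ ∃ v : n → ℂ, v ≠ 0 ∧ M *ᵥ v = 0 := by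
  open scoped ComplexOrder in
  simp_rw [← Matrix.exists_mulVec_eq_zero_iff, Matrix.conjTranspose_mul_self_mulVec_eq_zero]

/-- For nonnegative reals that are not both zero, the larger one equals the sum iff the product
vanishes. -/
lemma max_div_max_add_min_eq_one_iff {x y : ℝ} (hx : 0 ≤ x) (hy : 0 ≤ y) (h : x ≠ 0 ∨ y ≠ 0) :
    max x y / (max x y + min x y) = 1 ↔ x * y = 0 := by
  have hsum : x + y ≠ 0 := fun hs => by
    rcases h with h | h
    · exact h (by linarith)
    · exact h (by linarith)
  rw [max_add_min, div_eq_one_iff_eq hsum, mul_eq_zero]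
  rcases le_total x y with hxy | hxy
  · rw [max_eq_right hxy]
    exact ⟨fun _ => Or.inl (by linarith), fun h => by rcases h with h | h <;> linarith⟩
  · rw [max_eq_left hxy]
    exact ⟨fun _ => Or.inr (by linarith), fun h => by rcases h with h | h <;> linarith⟩

/-- For nonzero `a, b ∈ ℂ^m` and the 2×2 Hermitian PSD attack-angle matrix
`W = [a b]†[a b]` with eigenvalues `λ1 ≥ λ2 ≥ 0`, the index of separation
`IoS = λ1/(λ1+λ2)` equals 1 iff `a` and `b` are colinear. -/
theorem stmt11 {m : ℕ} (a b : Fin m → ℂ) (ha : a ≠ 0) (hb : b ≠ 0)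
    (M : Matrix (Fin m) (Fin 2) ℂ) (hM : M = Matrix.of fun i j => ![a i, b i] j)
    (W : Matrix (Fin 2) (Fin 2) ℂ) (hW : W = Mᴴ * M)
    (hHerm : W.IsHermitian)
    (lam1 lam2 : ℝ)
    (hlam1 : lam1 = max (hHerm.eigenvalues 0) (hHerm.eigenvalues 1))
    (hlam2 : lam2 = min (hHerm.eigenvalues 0) (hHerm.eigenvalues 1)) :
    lam1 / (lam1 + lam2) = 1 ↔ ∃ l : ℂ, l ≠ 0 ∧ a = l • b := by
  open scoped ComplexOrder in
  have hpos : W.PosSemidef := hW ▸ Matrix.posSemidef_conjTranspose_mul_self M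
  have hW0 : W ≠ 0 := by
    open scoped ComplexOrder in
    rw [hW, Ne, Matrix.conjTranspose_mul_self_eq_zero]
    intro h
    refine ha (funext fun i => ?_)
    simpa [hM] using congrFun (congrFun h i) 0
  have hne : hHerm.eigenvalues 0 ≠ 0 ∨ hHerm.eigenvalues 1 ≠ 0 := by
    by_contra! h
    exact hW0 (hHerm.eigenvalues_eq_zero_iff.1 (funext (Fin.forall_fin_two.2 h)))
  have hdet : hHerm.eigenvalues 0 * hHerm.eigenvalues 1 = 0 ↔ W.det = 0 := by
    rw [hHerm.det_eq_prod_eigenvalues, Fin.prod_univ_two, ← RCLike.ofReal_mul,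
      RCLike.ofReal_eq_zero]
  have hker (v : Fin 2 → ℂ) : M *ᵥ v = v 0 • a + v 1 • b := by
    ext i
    simp [hM, Matrix.mulVec, dotProduct, Fin.sum_univ_two, mul_comm]
  rw [hlam1, hlam2, max_div_max_add_min_eq_one_iff (hpos.eigenvalues_nonneg 0)
    (hpos.eigenvalues_nonneg 1) hne, hdet, hW, det_conjTranspose_mul_self_eq_zero_iff]
  simp_rw [hker]
  exact exists_ne_zero_add_eq_zero_iff ha hb
end
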